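/- Let n > 2 be an integer and let G be a graph cospectral with the friendship graph F_n. If the complement of G is disconnected, then G is isomorphic to F_n. -/

import Mathlib

open Polynomial

/-- The adjacency matrix of a simple graph, with entries in `R`. -/
noncomputable def adjMat (R : Type*) [Zero R] [One R] {V : Type*} [Fintype V]
    (G : SimpleGraph V) : Matrix V V R :=
  letI := Classical.decRel G.Adj
  G.adjMatrix R

/-- The friendship graph `F n`: `n` triangles glued at the common vertex `none`. -/
def friendshipGraph (n : ℕ) : SimpleGraph (Option (Fin n × Bool)) :=
  SimpleGraph.fromRel (fun u v =>
    u = none ∨ ∃ i : Fin n, u = some (i, true) ∧ v = some (i, false))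

/-- Two finite graphs are cospectral if their real adjacency matrices have the same
characteristic polynomial. -/
def Cospectral {V W : Type*} [Fintype V] [Fintype W] [DecidableEq V] [DecidableEq W]
    (G : SimpleGraph V) (H : SimpleGraph W) : Prop :=
  (adjMat ℝ G).charpoly = (adjMat ℝ H).charpoly

namespace Matrix.IsHermitian

/-- The trace of a power of a Hermitian matrix is the power sum of the roots of its
characteristic polynomial. -/
theorem trace_pow_eq_sum_roots_charpoly {n : Type*} [Fintype n] [DecidableEq n]
    {A : Matrix n n ℝ} (hA : A.IsHermitian) (k : ℕ) :
    (A ^ k).trace = (A.charpoly.roots.map (· ^ k)).sum := by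
  rw [hA.roots_charpoly_eq_eigenvalues]
  conv_lhs => rw [hA.spectral_theorem, ← map_pow, Unitary.conjStarAlgAut_apply,
    Matrix.trace_mul_comm, ← mul_assoc]
  simp [Matrix.diagonal_pow, Matrix.trace_diagonal]

end Matrix.IsHermitian

theorem adjMat_apply {V : Type*} [Fintype V] (G : SimpleGraph V) [DecidableRel G.Adj] (u v : V) :
    adjMat ℝ G u v = if G.Adj u v then 1 else 0 := by
  simp [adjMat, SimpleGraph.adjMatrix_apply]

theorem adjMat_comm {V : Type*} [Fintype V] (G : SimpleGraph V) (u v : V) :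
    adjMat ℝ G u v = adjMat ℝ G v u := by
  classical
  simp [adjMat_apply, G.adj_comm]

theorem isHermitian_adjMat {V : Type*} [Fintype V] (G : SimpleGraph V) :
    (adjMat ℝ G).IsHermitian := by
  ext u v
  simp [adjMat_comm G u v]

theorem sum_adjMat {V : Type*} [Fintype V] (G : SimpleGraph V) [DecidableRel G.Adj] (u : V) :
    ∑ v, adjMat ℝ G u v = G.degree u := by
  simp [adjMat_apply, ← SimpleGraph.card_neighborFinset_eq_degree,
    SimpleGraph.neighborFinset_eq_filter]

section Moments

variable {V : Type*} [Fintype V] [DecidableEq V] (G : SimpleGraph V)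

theorem adjMat_sq_apply (u v : V) :
    (adjMat ℝ G ^ 2) u v = ∑ w, adjMat ℝ G u w * adjMat ℝ G w v := by
  rw [pow_two, Matrix.mul_apply]

theorem adjMat_sq_apply_self [DecidableRel G.Adj] (u : V) :
    (adjMat ℝ G ^ 2) u u = G.degree u := by
  rw [adjMat_sq_apply, ← sum_adjMat]
  refine Finset.sum_congr rfl fun w _ => ?_
  rw [adjMat_comm G w u, adjMat_apply]
  split_ifs <;> simp

theorem trace_adjMat_sq [DecidableRel G.Adj] :
    (adjMat ℝ G ^ 2).trace = ∑ u, (G.degree u : ℝ) := by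
  simp [Matrix.trace, adjMat_sq_apply_self]

theorem trace_adjMat_pow_four :
    (adjMat ℝ G ^ 4).trace = ∑ u, ∑ v, ((adjMat ℝ G ^ 2) u v) ^ 2 := by
  have h : adjMat ℝ G ^ 4 = adjMat ℝ G ^ 2 * adjMat ℝ G ^ 2 := by rw [← pow_add]
  rw [h, Matrix.trace]
  refine Finset.sum_congr rfl fun u _ => ?_
  rw [Matrix.diag_apply, Matrix.mul_apply]
  refine Finset.sum_congr rfl fun v _ => ?_
  rw [pow_two ((adjMat ℝ G ^ 2) u v)]
  congr 1
  simpa using ((isHermitian_adjMat G).pow 2).apply u v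

theorem sum_adjMat_sq [DecidableRel G.Adj] :
    ∑ u, ∑ v, (adjMat ℝ G ^ 2) u v = ∑ w, (G.degree w : ℝ) ^ 2 := by
  simp_rw [adjMat_sq_apply]
  calc ∑ u, ∑ v, ∑ w, adjMat ℝ G u w * adjMat ℝ G w v
      = ∑ u, ∑ w, adjMat ℝ G w u * G.degree w := by
        refine Finset.sum_congr rfl fun u _ => ?_
        rw [Finset.sum_comm]
        refine Finset.sum_congr rfl fun w _ => ?_
        rw [← Finset.mul_sum, sum_adjMat, adjMat_comm]
    _ = ∑ w, (G.degree w : ℝ) ^ 2 := by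
        rw [Finset.sum_comm]
        refine Finset.sum_congr rfl fun w _ => ?_
        rw [← Finset.sum_mul, sum_adjMat, pow_two]

/-- The number of common neighbours of a dominating vertex and `v` is `deg v - 1`. -/
theorem adjMat_sq_apply_of_dominating [DecidableRel G.Adj] {c v : V}
    (hc : ∀ u, u ≠ c → G.Adj c u) (hv : v ≠ c) :
    (adjMat ℝ G ^ 2) c v = G.degree v - 1 := by
  rw [adjMat_sq_apply, ← sum_adjMat, eq_sub_iff_add_eq]
  have h1 : adjMat ℝ G v c = 1 := by simp [adjMat_apply, (hc v hv).symm]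
  rw [← Finset.add_sum_erase _ _ (Finset.mem_univ c),
    ← Finset.add_sum_erase _ (fun w => adjMat ℝ G v w) (Finset.mem_univ c), h1,
    adjMat_apply G c c]
  have h2 : ∑ w ∈ Finset.univ.erase c, adjMat ℝ G c w * adjMat ℝ G w v =
      ∑ w ∈ Finset.univ.erase c, adjMat ℝ G v w := by
    refine Finset.sum_congr rfl fun w hw => ?_
    rw [adjMat_apply G c w, if_pos (hc w (Finset.ne_of_mem_erase hw)), one_mul, adjMat_comm]
  rw [h2]
  simp [add_comm]

theorem degree_of_dominating [DecidableRel G.Adj] {c : V} (hc : ∀ u, u ≠ c → G.Adj c u) :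
    G.degree c + 1 = Fintype.card V := by
  have : G.neighborFinset c = Finset.univ.erase c := by
    ext u
    simp only [SimpleGraph.mem_neighborFinset, Finset.mem_erase, Finset.mem_univ, and_true]
    exact ⟨fun h => h.ne', hc u⟩
  rw [← SimpleGraph.card_neighborFinset_eq_degree, this, Finset.card_erase_add_one
    (Finset.mem_univ c), Finset.card_univ]

/-- A lower bound for the fourth spectral moment of a graph with a dominating vertex, obtained
by discarding the pairs of distinct non-dominating vertices. -/
theorem trace_adjMat_pow_four_ge_of_dominating [DecidableRel G.Adj] {c : V}
    (hc : ∀ u, u ≠ c → G.Adj c u) :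
    ∑ u, ((G.degree u : ℝ) - 1) ^ 2
        + 2 * (∑ u, ((G.degree u : ℝ) - 2) ^ 2 - ((G.degree c : ℝ) - 2) ^ 2)
      ≤ (adjMat ℝ G ^ 4).trace - 2 * ∑ u, (G.degree u : ℝ) ^ 2 + (Fintype.card V : ℝ) ^ 2 := by
  have hr : (adjMat ℝ G ^ 4).trace - 2 * ∑ u, (G.degree u : ℝ) ^ 2 + (Fintype.card V : ℝ) ^ 2
      = ∑ u, ∑ v, ((adjMat ℝ G ^ 2) u v - 1) ^ 2 := by
    rw [trace_adjMat_pow_four, ← sum_adjMat_sq]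
    simp only [sub_sq, Finset.sum_add_distrib, Finset.sum_sub_distrib, mul_one, one_pow,
      ← Finset.mul_sum]
    simp [pow_two]
  have hs : ((adjMat ℝ G ^ 2)).IsHermitian := (isHermitian_adjMat G).pow 2
  have hsplit : ∑ u, ((G.degree u : ℝ) - 2) ^ 2 - ((G.degree c : ℝ) - 2) ^ 2
      = ∑ u, if u = c then 0 else ((G.degree u : ℝ) - 2) ^ 2 := by
    rw [← Finset.add_sum_erase _ _ (Finset.mem_univ c),
      ← Finset.add_sum_erase _ (fun u => if u = c then 0 else ((G.degree u : ℝ) - 2) ^ 2)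
        (Finset.mem_univ c)]
    have : ∑ u ∈ Finset.univ.erase c, (if u = c then 0 else ((G.degree u : ℝ) - 2) ^ 2) =
        ∑ u ∈ Finset.univ.erase c, ((G.degree u : ℝ) - 2) ^ 2 :=
      Finset.sum_congr rfl fun u hu => if_neg (Finset.ne_of_mem_erase hu)
    rw [this]
    simp
  have hl : ∑ u, ((G.degree u : ℝ) - 1) ^ 2
        + 2 * (∑ u, ((G.degree u : ℝ) - 2) ^ 2 - ((G.degree c : ℝ) - 2) ^ 2)
      = ∑ u, ∑ v, ((if u = v then ((G.degree u : ℝ) - 1) ^ 2 else 0)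
        + (if u = c then (if v = c then 0 else ((G.degree v : ℝ) - 2) ^ 2) else 0)
        + (if v = c then (if u = c then 0 else ((G.degree u : ℝ) - 2) ^ 2) else 0)) := by
    rw [hsplit]
    simp only [Finset.sum_add_distrib]
    rw [Finset.sum_comm (f := fun u v =>
      if u = c then (if v = c then 0 else ((G.degree v : ℝ) - 2) ^ 2) else 0)]
    simp only [Finset.sum_ite_eq, Finset.sum_ite_eq', Finset.mem_univ, if_true]
    ring
  rw [hr, hl]
  refine Finset.sum_le_sum fun u _ => Finset.sum_le_sum fun v _ => ?_
  by_cases huv : u = v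
  · subst huv
    rw [adjMat_sq_apply_self]
    by_cases huc : u = c <;> simp [huc]
  · by_cases huc : u = c
    · subst huc
      rw [adjMat_sq_apply_of_dominating G hc (Ne.symm huv)]
      simp only [huv, Ne.symm huv, if_true, if_false]
      apply le_of_eq
      ring
    · by_cases hvc : v = c
      · subst hvc
        have : (adjMat ℝ G ^ 2) u v = (adjMat ℝ G ^ 2) v u := by simpa using hs.apply v u
        rw [this, adjMat_sq_apply_of_dominating G hc huc]
        simp only [huc, if_true, if_false]
        apply le_of_eq
        ring
      · simp only [huv, huc, hvc, if_false, add_zero]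
        positivity

end Moments

namespace Cospectral

variable {V W : Type*} [Fintype V] [Fintype W] [DecidableEq V] [DecidableEq W]
  {G : SimpleGraph V} {H : SimpleGraph W}

theorem card_eq (h : Cospectral G H) : Fintype.card V = Fintype.card W := by
  have := congrArg Polynomial.natDegree h
  simpa [Matrix.charpoly_natDegree_eq_dim] using this

theorem trace_pow_eq (h : Cospectral G H) (k : ℕ) :
    (adjMat ℝ G ^ k).trace = (adjMat ℝ H ^ k).trace := by
  rw [(isHermitian_adjMat G).trace_pow_eq_sum_roots_charpoly,
    (isHermitian_adjMat H).trace_pow_eq_sum_roots_charpoly, h]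

end Cospectral

namespace friendshipGraph

variable (n : ℕ)

theorem adj_none_some (p : Fin n × Bool) : (friendshipGraph n).Adj none (some p) := by
  simp [friendshipGraph]

theorem adj_some_some (p q : Fin n × Bool) :
    (friendshipGraph n).Adj (some p) (some q) ↔ p.1 = q.1 ∧ p.2 ≠ q.2 := by
  obtain ⟨i, a⟩ := p
  obtain ⟨j, b⟩ := q
  cases a <;> cases b <;> simp [friendshipGraph, eq_comm]

theorem adjMat_none_none : adjMat ℝ (friendshipGraph n) none none = 0 := by
  classical
  simp [adjMat_apply]

theorem adjMat_none_some (p : Fin n × Bool) :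
    adjMat ℝ (friendshipGraph n) none (some p) = 1 := by
  classical
  simp [adjMat_apply, adj_none_some]

theorem adjMat_some_some (p q : Fin n × Bool) :
    adjMat ℝ (friendshipGraph n) (some p) (some q) = if q = (p.1, !p.2) then 1 else 0 := by
  classical
  rw [adjMat_apply]
  congr 1
  obtain ⟨i, a⟩ := p
  obtain ⟨j, b⟩ := q
  cases a <;> cases b <;> simp [adj_some_some, eq_comm]

theorem adjMat_sq_none_none : (adjMat ℝ (friendshipGraph n) ^ 2) none none = 2 * n := by
  rw [adjMat_sq_apply, Fintype.sum_option]
  simp only [adjMat_comm _ (some _) none, adjMat_none_none, adjMat_none_some]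
  simp [mul_comm]

theorem adjMat_sq_none_some (p : Fin n × Bool) :
    (adjMat ℝ (friendshipGraph n) ^ 2) none (some p) = 1 := by
  rw [adjMat_sq_apply, Fintype.sum_option]
  simp [adjMat_comm _ (some _) (some p), adjMat_none_none, adjMat_none_some, adjMat_some_some]

theorem adjMat_sq_some_some (p q : Fin n × Bool) :
    (adjMat ℝ (friendshipGraph n) ^ 2) (some p) (some q) = if p = q then 2 else 1 := by
  have h : ∀ r : Fin n × Bool, adjMat ℝ (friendshipGraph n) (some r) (some q) =
      if r = (q.1, !q.2) then 1 else 0 := fun r => by rw [adjMat_comm, adjMat_some_some]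
  have hpq : (q.1, !q.2) = (p.1, !p.2) ↔ p = q := by
    simp [Prod.ext_iff, eq_comm]
  rw [adjMat_sq_apply, Fintype.sum_option, adjMat_comm _ (some p) none]
  simp only [adjMat_none_some, adjMat_some_some, h, mul_ite, mul_one, mul_zero,
    Finset.sum_ite_eq', Finset.mem_univ, if_true, hpq]
  split_ifs <;> norm_num

theorem adjMat_sq_some_none (p : Fin n × Bool) :
    (adjMat ℝ (friendshipGraph n) ^ 2) (some p) none = 1 := by
  rw [← adjMat_sq_none_some n p]
  simpa using ((isHermitian_adjMat (friendshipGraph n)).pow 2).apply none (some p)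

theorem trace_adjMat_sq : (adjMat ℝ (friendshipGraph n) ^ 2).trace = 6 * n := by
  rw [Matrix.trace, Fintype.sum_option]
  simp only [Matrix.diag_apply, adjMat_sq_none_none, adjMat_sq_some_some]
  simp
  ring

theorem trace_adjMat_pow_four :
    (adjMat ℝ (friendshipGraph n) ^ 4).trace = 8 * n ^ 2 + 10 * n := by
  have h : ∀ p q : Fin n × Bool,
      (if p = q then (2 : ℝ) else 1) ^ 2 = 1 + if p = q then 3 else 0 := by
    intro p q
    split_ifs <;> norm_num
  rw [_root_.trace_adjMat_pow_four, Fintype.sum_option]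
  simp only [Fintype.sum_option, adjMat_sq_none_none, adjMat_sq_none_some, adjMat_sq_some_none,
    adjMat_sq_some_some, h, Finset.sum_add_distrib, Finset.sum_ite_eq, Finset.mem_univ, if_true]
  simp
  ring

end friendshipGraph

theorem exists_dominating_of_card_eq_one {V : Type*} {G : SimpleGraph V} {S : Finset V}
    (hS : ∀ u ∈ S, ∀ v ∉ S, G.Adj u v) (h : S.card = 1) : ∃ c, ∀ u, u ≠ c → G.Adj c u := by
  obtain ⟨c, rfl⟩ := Finset.card_eq_one.mp h
  exact ⟨c, fun u hu => hS c (by simp) u (by simpa using hu)⟩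

section Structure

variable {V : Type*} [Fintype V] [DecidableEq V] {G : SimpleGraph V}

/-- If `S` is completely joined to its complement, then twice the number of joining edges is at
most the degree sum. -/
theorem two_mul_card_mul_card_compl_le [DecidableRel G.Adj] (S : Finset V)
    (hS : ∀ u ∈ S, ∀ v ∉ S, G.Adj u v) :
    2 * (S.card * Sᶜ.card) ≤ ∑ u, G.degree u := by
  rw [← Finset.sum_add_sum_compl S]
  have h1 : ∑ u ∈ S, Sᶜ.card ≤ ∑ u ∈ S, G.degree u := by
    refine Finset.sum_le_sum fun u hu => ?_
    rw [← SimpleGraph.card_neighborFinset_eq_degree]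
    refine Finset.card_le_card fun v hv => ?_
    simpa using hS u hu v (by simpa using hv)
  have h2 : ∑ u ∈ Sᶜ, S.card ≤ ∑ u ∈ Sᶜ, G.degree u := by
    refine Finset.sum_le_sum fun u hu => ?_
    rw [← SimpleGraph.card_neighborFinset_eq_degree]
    refine Finset.card_le_card fun v hv => ?_
    simpa using (hS v hv u (by simpa using hu)).symm
  simp only [Finset.sum_const, smul_eq_mul] at h1 h2
  linarith [mul_comm S.card Sᶜ.card]

/-- A graph on `2 * n + 1` vertices with `3 * n` edges and disconnected complement has a
dominating vertex. -/
theorem exists_dominating_of_not_connected_compl [DecidableRel G.Adj] {n : ℕ} (hn : 2 < n)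
    (hcard : Fintype.card V = 2 * n + 1) (hdeg : ∑ u, G.degree u = 6 * n)
    (hdisc : ¬ Gᶜ.Connected) : ∃ c, ∀ u, u ≠ c → G.Adj c u := by
  classical
  have : Nonempty V := Fintype.card_pos_iff.mp (by omega)
  have hpre : ¬ Gᶜ.Preconnected := fun h => hdisc ⟨h⟩
  simp only [SimpleGraph.Preconnected, not_forall] at hpre
  obtain ⟨a, b, hab⟩ := hpre
  let S : Finset V := Finset.univ.filter fun v => Gᶜ.Reachable a v
  have hS : ∀ u ∈ S, ∀ v ∉ S, G.Adj u v := by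
    intro u hu v hv
    simp only [S, Finset.mem_filter, Finset.mem_univ, true_and] at hu hv
    by_contra h
    refine hv (hu.trans (SimpleGraph.Adj.reachable ?_))
    rw [SimpleGraph.compl_adj]
    exact ⟨fun huv => hv (huv ▸ hu), h⟩
  have ha : 0 < S.card := Finset.card_pos.mpr ⟨a, by simp [S]⟩
  have hb : 0 < Sᶜ.card := Finset.card_pos.mpr ⟨b, by simpa [S] using hab⟩
  have hsum := Finset.card_add_card_compl S
  have hle := two_mul_card_mul_card_compl_le S hS
  rw [hdeg] at hle
  rw [hcard] at hsum
  by_cases h1 : S.card = 1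
  · exact exists_dominating_of_card_eq_one hS h1
  by_cases h2 : Sᶜ.card = 1
  · exact exists_dominating_of_card_eq_one
      (fun u hu v hv => (hS v (by simpa using hv) u (by simpa using hu)).symm) h2
  exfalso
  obtain ⟨x, hx⟩ : ∃ x, S.card = x + 2 := ⟨S.card - 2, by omega⟩
  obtain ⟨y, hy⟩ : ∃ y, Sᶜ.card = y + 2 := ⟨Sᶜ.card - 2, by omega⟩
  rw [hx, hy] at hle hsum
  nlinarith [Nat.zero_le (x * y)]

/-- If `c` is dominating and all other vertices have degree two, the graph is a friendship
graph. -/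
theorem nonempty_iso_friendshipGraph [DecidableRel G.Adj] {n : ℕ} {c : V}
    (hcard : Fintype.card V = 2 * n + 1) (hc : ∀ u, u ≠ c → G.Adj c u)
    (hdeg : ∀ v, v ≠ c → G.degree v = 2) : Nonempty (G ≃g friendshipGraph n) := by
  have hpartner : ∀ v : V, v ≠ c → ∃ w, ∀ x, (x ≠ c ∧ G.Adj v x) ↔ x = w := by
    intro v hv
    have h : ((G.neighborFinset v).erase c).card = 1 := by
      rw [Finset.card_erase_of_mem (by simpa using (hc v hv).symm),
        SimpleGraph.card_neighborFinset_eq_degree, hdeg v hv]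
    obtain ⟨w, hw⟩ := Finset.card_eq_one.mp h
    refine ⟨w, fun x => ?_⟩
    have := Finset.ext_iff.mp hw x
    simpa using this
  choose! σ hσ using hpartner
  have hσc : ∀ v, v ≠ c → σ v ≠ c := fun v hv => ((hσ v hv (σ v)).mpr rfl).1
  have hσadj : ∀ v, v ≠ c → G.Adj v (σ v) := fun v hv => ((hσ v hv (σ v)).mpr rfl).2
  have hσσ : ∀ v, v ≠ c → σ (σ v) = v := fun v hv =>
    ((hσ (σ v) (hσc v hv) v).mp ⟨hv, (hσadj v hv).symm⟩).symm
  have hσne : ∀ v, v ≠ c → σ v ≠ v := fun v hv => (hσadj v hv).ne'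
  let key := Fintype.equivFin V
  let E := {v : V // v ≠ c ∧ key v < key (σ v)}
  let f : Option (E × Bool) → V := fun p => p.elim c fun q => if q.2 then q.1.1 else σ q.1.1
  have hfne : ∀ q : E × Bool, f (some q) ≠ c := by
    rintro ⟨⟨v, hv, hlt⟩, b⟩
    cases b
    · exact hσc v hv
    · exact hv
  have hfσ : ∀ q : E × Bool, σ (f (some q)) = f (some (q.1, !q.2)) := by
    rintro ⟨⟨v, hv, hlt⟩, b⟩
    cases b
    · exact hσσ v hv
    · rfl
  have hinj : Function.Injective f := by
    rintro (_ | p) (_ | q) h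
    · rfl
    · exact absurd h.symm (hfne q)
    · exact absurd h (hfne p)
    · obtain ⟨⟨v, hv, hlt⟩, a⟩ := p
      obtain ⟨⟨w, hw, hlt'⟩, b⟩ := q
      cases a <;> cases b
      · have h' : σ v = σ w := h
        have : v = w := by rw [← hσσ v hv, h', hσσ w hw]
        subst this
        rfl
      · have h' : σ v = w := h
        subst h'
        rw [hσσ v hv] at hlt'
        exact absurd hlt' hlt.not_gt
      · have h' : v = σ w := h
        subst h'
        rw [hσσ w hw] at hlt
        exact absurd hlt hlt'.not_gt
      · have h' : v = w := h
        subst h'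
        rfl
  have hsurj : Function.Surjective f := by
    intro v
    by_cases hv : v = c
    · exact ⟨none, hv.symm⟩
    rcases lt_or_gt_of_ne (fun h => hσne v hv (key.injective h).symm : key v ≠ key (σ v)) with h | h
    · exact ⟨some (⟨v, hv, h⟩, true), rfl⟩
    · exact ⟨some (⟨σ v, hσc v hv, by rwa [hσσ v hv]⟩, false), hσσ v hv⟩
  let e : Option (E × Bool) ≃ V := Equiv.ofBijective f ⟨hinj, hsurj⟩
  have hE : Fintype.card E = n := by
    have := Fintype.card_congr e
    rw [Fintype.card_option, Fintype.card_prod, Fintype.card_bool] at this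
    have := this.trans hcard
    omega
  let g : E ≃ Fin n := Fintype.equivFinOfCardEq hE
  let t : Option (E × Bool) ≃ Option (Fin n × Bool) :=
    Equiv.optionCongr (g.prodCongr (Equiv.refl Bool))
  have hadj : ∀ x y, (friendshipGraph n).Adj (t x) (t y) ↔ G.Adj (f x) (f y) := by
    rintro (_ | p) (_ | q)
    · exact iff_of_false (SimpleGraph.irrefl _) (SimpleGraph.irrefl _)
    · exact iff_of_true (friendshipGraph.adj_none_some n _) (hc _ (hfne q))
    · exact iff_of_true (friendshipGraph.adj_none_some n _).symm (hc _ (hfne p)).symm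
    · have h1 : G.Adj (f (some p)) (f (some q)) ↔ f (some q) = σ (f (some p)) := by
        rw [← hσ _ (hfne p)]
        exact ⟨fun h => ⟨hfne q, h⟩, fun h => h.2⟩
      rw [h1, hfσ, hinj.eq_iff]
      refine (friendshipGraph.adj_some_some n _ _).trans ?_
      obtain ⟨v, a⟩ := p
      obtain ⟨w, b⟩ := q
      cases a <;> cases b <;> simp [eq_comm]
  exact ⟨⟨e.symm.trans t, fun {x y} => by
    rw [Equiv.trans_apply, Equiv.trans_apply, hadj]
    exact iff_of_eq (congrArg₂ G.Adj (e.apply_symm_apply x) (e.apply_symm_apply y))⟩⟩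

end Structure

/-- for `n > 2`, if `G` is cospectral with the friendship graph `F n` and the
complement of `G` is disconnected, then `G ≅ F n`. -/
theorem complement_disconnected_iso
    {V : Type*} [Fintype V] [DecidableEq V]
    (n : ℕ) (hn : 2 < n) (G : SimpleGraph V)
    (hG : Cospectral G (friendshipGraph n))
    (hdisc : ¬ Gᶜ.Connected) :
    Nonempty (G ≃g friendshipGraph n) := by
  classical
  have hcard : Fintype.card V = 2 * n + 1 := by
    rw [hG.card_eq]
    simp [mul_comm]
  have hdeg : ∑ u, (G.degree u : ℝ) = 6 * n := by
    rw [← trace_adjMat_sq, hG.trace_pow_eq, friendshipGraph.trace_adjMat_sq]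
  obtain ⟨c, hc⟩ := exists_dominating_of_not_connected_compl hn hcard
    (by exact_mod_cast hdeg) hdisc
  have hdc : (G.degree c : ℝ) = 2 * n := by
    have := degree_of_dominating G hc
    rw [hcard] at this
    exact_mod_cast Nat.succ_injective this
  refine nonempty_iso_friendshipGraph hcard hc fun v hv => ?_
  have hge := trace_adjMat_pow_four_ge_of_dominating G hc
  have hone : ∑ u, ((G.degree u : ℝ) - 1) ^ 2
      = ∑ u, (G.degree u : ℝ) ^ 2 - 2 * (6 * n) + (2 * n + 1) := by
    simp only [sub_sq, Finset.sum_add_distrib, Finset.sum_sub_distrib, mul_one, one_pow,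
      ← Finset.mul_sum, hdeg]
    simp [hcard]
  have htwo : ∑ u, ((G.degree u : ℝ) - 2) ^ 2
      = ∑ u, (G.degree u : ℝ) ^ 2 - 4 * (6 * n) + 4 * (2 * n + 1) := by
    simp only [sub_sq, Finset.sum_add_distrib, Finset.sum_sub_distrib, ← Finset.mul_sum,
      ← Finset.sum_mul, hdeg]
    simp [hcard]
    ring
  rw [hG.trace_pow_eq, friendshipGraph.trace_adjMat_pow_four, hdc, hcard, hone, htwo] at hge
  push_cast at hge
  have hpair : ((G.degree c : ℝ) - 2) ^ 2 + ((G.degree v : ℝ) - 2) ^ 2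
      ≤ ∑ u, ((G.degree u : ℝ) - 2) ^ 2 := by
    rw [← Finset.sum_pair (f := fun u => ((G.degree u : ℝ) - 2) ^ 2) hv.symm]
    exact Finset.sum_le_sum_of_subset_of_nonneg (Finset.subset_univ _) fun _ _ _ => sq_nonneg _
  rw [htwo, hdc] at hpair
  have hsq : ((G.degree v : ℝ) - 2) ^ 2 = 0 := le_antisymm (by nlinarith) (sq_nonneg _)
  have : (G.degree v : ℝ) = 2 := by linarith [pow_eq_zero_iff (two_ne_zero) |>.mp hsq]
  exact_mod_cast this
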